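/- arXiv:2508.12850 — 5 statements merged into one kernel-verified Lean document; each statement's English description precedes it below -/
import Mathlib

section
/- Let 𝒫, 𝒬 ∈ ℝ^{l×n}, a, b ∈ ℝ^l, and let S = {v ∈ ℝ^n : (𝒫v+a)_i ≥ 0, (𝒬v+b)_i ≥ 0, and (𝒫v+a)_i·(𝒬v+b)_i = 0 for all i ∈ {1,…,l}}. Fix v* ∈ S and define I_G = {i : (𝒫v*+a)_i = 0 < (𝒬v*+b)_i}, I_H = {i : (𝒬v*+b)_i = 0 < (𝒫v*+a)_i}, I_GH = {i : (𝒫v*+a)_i = 0 = (𝒬v*+b)_i}. Then the Bouligand tangent cone of S at v* — the set of all d ∈ ℝ^n such that there exist sequences d_n → d and t_n ↓ 0 with v* + t_n d_n ∈ S for all n — equals the MPEC-linearized cone {d ∈ ℝ^n : (𝒫d)_i = 0 for all i ∈ I_G, (𝒬d)_i = 0 for all i ∈ I_H, and (𝒫d)_i ≥ 0, (𝒬d)_i ≥ 0, (𝒫d)_i·(𝒬d)_i = 0 for all i ∈ I_GH}. In particular, MPEC-ACQ holds at every feasible point of an MPEC with affine constraint data. -/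
/-!
STATEMENT 10: For an affine complementarity set
`S = {v | 𝒫v+a ≥ 0, 𝒬v+b ≥ 0, (𝒫v+a)ᵢ(𝒬v+b)ᵢ = 0}` and `v* ∈ S`,
the Bouligand tangent cone of `S` at `v*` equals the MPEC-linearized cone.
(`t_n ↓ 0` is encoded as: `t_n > 0`, antitone, converging to `0`.)
-/

open Filter

theorem aux_fwd {p q x y : ℝ} {xn yn tn : ℕ → ℝ} (hx : Tendsto xn atTop (nhds x))
    (hy : Tendsto yn atTop (nhds y)) (ht : Tendsto tn atTop (nhds 0)) (hpos : ∀ k, 0 < tn k)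
    (h : ∀ k, (p + tn k * xn k) * (q + tn k * yn k) = 0) (hp : p = 0) (hq : 0 < q) : x = 0 := by
  have h1 : Tendsto (fun k => q + tn k * yn k) atTop (nhds (q + 0 * y)) :=
    tendsto_const_nhds.add (ht.mul hy)
  have h2 : ∀ᶠ k in atTop, 0 < q + tn k * yn k :=
    h1.eventually (lt_mem_nhds (by simpa using hq))
  have h3 : ∀ᶠ k in atTop, xn k = 0 := by
    filter_upwards [h2] with k hk
    have := h k
    subst hp
    rcases mul_eq_zero.mp this with h4 | h4
    · rw [zero_add] at h4
      exact (mul_eq_zero.mp h4).resolve_left (hpos k).ne'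
    · exact absurd h4 hk.ne'
  exact tendsto_nhds_unique hx (tendsto_const_nhds.congr' (h3.mono fun k hk => hk.symm))

theorem aux_pos {p : ℝ} (x : ℝ) (hp : 0 < p) : ∀ᶠ t in nhdsWithin (0 : ℝ) (Set.Ioi 0), 0 < p + t * x := by
  have h : Tendsto (fun t : ℝ => p + t * x) (nhds 0) (nhds (p + 0 * x)) :=
    (by fun_prop : Continuous (fun t : ℝ => p + t * x)).tendsto 0
  exact (h.eventually (lt_mem_nhds (by simpa using hp))).filter_mono nhdsWithin_le_nhds

theorem tangentCone_eq_mpecLinearizedCone_of_affine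
    (n l : ℕ) (P Q : Matrix (Fin l) (Fin n) ℝ) (a b : Fin l → ℝ)
    (S : Set (Fin n → ℝ))
    (hS : S = {v | ∀ i, 0 ≤ (P.mulVec v + a) i ∧ 0 ≤ (Q.mulVec v + b) i ∧
                    (P.mulVec v + a) i * (Q.mulVec v + b) i = 0})
    (v : Fin n → ℝ) (hv : v ∈ S) :
    -- Bouligand tangent cone of S at v
    {d : Fin n → ℝ | ∃ (dn : ℕ → (Fin n → ℝ)) (tn : ℕ → ℝ),
        Tendsto dn atTop (nhds d) ∧
        (∀ k, 0 < tn k) ∧ Antitone tn ∧ Tendsto tn atTop (nhds 0) ∧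
        ∀ k, v + tn k • dn k ∈ S}
    =
    -- MPEC-linearized cone at v
    {d : Fin n → ℝ |
        (∀ i, (P.mulVec v + a) i = 0 → 0 < (Q.mulVec v + b) i → P.mulVec d i = 0) ∧
        (∀ i, 0 < (P.mulVec v + a) i → (Q.mulVec v + b) i = 0 → Q.mulVec d i = 0) ∧
        (∀ i, (P.mulVec v + a) i = 0 → (Q.mulVec v + b) i = 0 →
          0 ≤ P.mulVec d i ∧ 0 ≤ Q.mulVec d i ∧ P.mulVec d i * Q.mulVec d i = 0)} := by
  have key : ∀ (M : Matrix (Fin l) (Fin n) ℝ) (c : Fin l → ℝ) (t : ℝ) (d : Fin n → ℝ) (i : Fin l),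
      (M.mulVec (v + t • d) + c) i = (M.mulVec v + c) i + t * M.mulVec d i := by
    intro M c t d i
    simp only [Matrix.mulVec_add, Matrix.mulVec_smul, Pi.add_apply, Pi.smul_apply, smul_eq_mul]
    ring
  subst hS
  simp only [Set.mem_setOf_eq] at hv
  ext d
  simp only [Set.mem_setOf_eq, key]
  constructor
  · rintro ⟨dn, tn, hd, hpos, -, ht, hmem⟩
    have hM : ∀ (M : Matrix (Fin l) (Fin n) ℝ) (i : Fin l),
        Tendsto (fun k => M.mulVec (dn k) i) atTop (nhds (M.mulVec d i)) := by
      intro M i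
      have hc : Continuous (fun w : Fin n → ℝ => M.mulVec w i) :=
        (continuous_apply i).comp (Continuous.matrix_mulVec continuous_const continuous_id)
      exact (hc.tendsto d).comp hd
    refine ⟨fun i hp hq => ?_, fun i hp hq => ?_, fun i hp hq => ?_⟩
    · exact aux_fwd (hM P i) (hM Q i) ht hpos (fun k => (hmem k i).2.2) hp hq
    · exact aux_fwd (hM Q i) (hM P i) ht hpos
        (fun k => by rw [mul_comm]; exact (hmem k i).2.2) hq hp
    · refine ⟨ge_of_tendsto' (hM P i) fun k => ?_, ge_of_tendsto' (hM Q i) fun k => ?_, ?_⟩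
      · have := (hmem k i).1
        rw [hp, zero_add] at this
        exact nonneg_of_mul_nonneg_right this (hpos k)
      · have := (hmem k i).2.1
        rw [hq, zero_add] at this
        exact nonneg_of_mul_nonneg_right this (hpos k)
      · refine tendsto_nhds_unique ((hM P i).mul (hM Q i)) (tendsto_const_nhds.congr fun k => ?_)
        have := (hmem k i).2.2
        rw [hp, hq, zero_add, zero_add] at this
        have h0 := (hpos k).ne'
        simpa [h0] using this.symm
  · rintro ⟨h1, h2, h3⟩
    have hev : ∀ᶠ t in nhdsWithin (0 : ℝ) (Set.Ioi 0), ∀ i,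
        0 ≤ (P.mulVec v + a) i + t * P.mulVec d i ∧ 0 ≤ (Q.mulVec v + b) i + t * Q.mulVec d i ∧
        ((P.mulVec v + a) i + t * P.mulVec d i) * ((Q.mulVec v + b) i + t * Q.mulVec d i) = 0 := by
      rw [eventually_all]
      intro i
      obtain ⟨hp, hq, hpq⟩ := hv i
      rcases hp.eq_or_lt with hp | hp
      · rcases hq.eq_or_lt with hq | hq
        · obtain ⟨e1, e2, e3⟩ := h3 i hp.symm hq.symm
          filter_upwards [self_mem_nhdsWithin] with t ht
          have ht' : 0 < t := ht
          rw [← hp, ← hq, zero_add, zero_add]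
          refine ⟨by positivity, by positivity, ?_⟩
          linear_combination t * t * e3
        · have e := h1 i hp.symm hq
          filter_upwards [aux_pos (Q.mulVec d i) hq] with t ht
          rw [← hp, e]
          exact ⟨by simp, ht.le, by simp⟩
      · have hq0 := (mul_eq_zero.mp hpq).resolve_left hp.ne'
        have e := h2 i hp hq0
        filter_upwards [aux_pos (P.mulVec d i) hp] with t ht
        rw [hq0, e]
        exact ⟨ht.le, by simp, by simp⟩
    obtain ⟨ε, hε, hsub⟩ := mem_nhdsGT_iff_exists_Ioc_subset.mp hev
    have hε' : 0 < ε := hε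
    refine ⟨fun _ => d, fun k => ε * (1 / ((k : ℝ) + 1)), tendsto_const_nhds,
      fun k => by positivity, ?_, ?_, fun k => ?_⟩
    · intro j k hjk
      exact mul_le_mul_of_nonneg_left (Nat.one_div_le_one_div hjk) hε'.le
    · simpa using (tendsto_one_div_add_atTop_nhds_zero_nat (𝕜 := ℝ)).const_mul ε
    · refine hsub ⟨by positivity, ?_⟩
      have : 1 / ((k : ℝ) + 1) ≤ 1 := by
        rw [div_le_one (by positivity)]
        linarith [Nat.cast_nonneg (α := ℝ) k]
      nlinarith
end

section
/- Let v* = (C, ζ, z, α, ξ) be a feasible point of the BHO-SVM MPEC with C > 0 and such that (Mα)_i ≠ 0 for every i ∈ {1,…,s}. If the principal submatrix K_(Λ1∪Λ3, Λ1∪Λ3) is positive definite, then MPEC-MFCQ-R holds at v*: the only scalars β_i (i ∈ I_G ∪ I_GH) and γ_i (i ∈ I_H ∪ I_GH) satisfying β_i ≥ 0 and γ_i ≥ 0 for all i ∈ I_GH and Σ_{i∈I_G∪I_GH} β_i ∇G_i(v*) + Σ_{i∈I_H∪I_GH} γ_i ∇H_i(v*) = 0 are all zero. -/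
/-!
STATEMENT 11: At a feasible point of the BHO-SVM MPEC with C > 0, (Mα)ᵢ ≠ 0 for all i,
and K_(Λ1∪Λ3, Λ1∪Λ3) positive definite, MPEC-MFCQ-R holds.
-/

noncomputable section

/-- Index of the `2s+2q` complementarity constraint pairs of the BHO-SVM MPEC:
`s` pairs `(ζᵢ, (Mα+z)ᵢ)`, `s` pairs `(zᵢ, 1-ζᵢ)`, `q` pairs `(αᵢ, (Kα-1+ξ)ᵢ)`,
`q` pairs `(ξᵢ, C-αᵢ)`. -/
abbrev BIdx (s q : ℕ) := Fin s ⊕ Fin s ⊕ Fin q ⊕ Fin q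

/-- Variable space of the BHO-SVM MPEC: `v = (C, ζ, z, α, ξ)`. -/
abbrev BVec (s q : ℕ) := ℝ × (Fin s → ℝ) × (Fin s → ℝ) × (Fin q → ℝ) × (Fin q → ℝ)

/-- `H(v) = (ζ, z, α, ξ)`. -/
def bH {s q : ℕ} : BIdx s q → BVec s q → ℝ
  | Sum.inl i, v => v.2.1 i
  | Sum.inr (Sum.inl i), v => v.2.2.1 i
  | Sum.inr (Sum.inr (Sum.inl i)), v => v.2.2.2.1 i
  | Sum.inr (Sum.inr (Sum.inr i)), v => v.2.2.2.2 i

/-- `G(v) = (Mα+z, 1-ζ, Kα-1+ξ, C·1-α)`. -/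
def bG {s q : ℕ} (M : Matrix (Fin s) (Fin q) ℝ) (K : Matrix (Fin q) (Fin q) ℝ) :
    BIdx s q → BVec s q → ℝ
  | Sum.inl i, v => M.mulVec v.2.2.2.1 i + v.2.2.1 i
  | Sum.inr (Sum.inl i), v => 1 - v.2.1 i
  | Sum.inr (Sum.inr (Sum.inl i)), v => K.mulVec v.2.2.2.1 i - 1 + v.2.2.2.2 i
  | Sum.inr (Sum.inr (Sum.inr i)), v => v.1 - v.2.2.2.1 i

/-- `∇H_i(v)`: the gradients of the (affine) functions `H_i`, as vectors of `BVec s q`. -/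
def bGradH {s q : ℕ} : BIdx s q → BVec s q
  | Sum.inl i => (0, Pi.single i 1, 0, 0, 0)
  | Sum.inr (Sum.inl i) => (0, 0, Pi.single i 1, 0, 0)
  | Sum.inr (Sum.inr (Sum.inl i)) => (0, 0, 0, Pi.single i 1, 0)
  | Sum.inr (Sum.inr (Sum.inr i)) => (0, 0, 0, 0, Pi.single i 1)

/-- `∇G_i(v)`: the gradients of the (affine) functions `G_i`, as vectors of `BVec s q`. -/
def bGradG {s q : ℕ} (M : Matrix (Fin s) (Fin q) ℝ) (K : Matrix (Fin q) (Fin q) ℝ) :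
    BIdx s q → BVec s q
  | Sum.inl i => (0, 0, Pi.single i 1, fun j => M i j, 0)
  | Sum.inr (Sum.inl i) => (0, -Pi.single i 1, 0, 0, 0)
  | Sum.inr (Sum.inr (Sum.inl i)) => (0, 0, 0, fun j => K i j, Pi.single i 1)
  | Sum.inr (Sum.inr (Sum.inr i)) => (1, 0, 0, -Pi.single i 1, 0)

/-- The principal submatrix `K_(Λ,Λ)` is positive definite. -/
def posDefOn {q : ℕ} (K : Matrix (Fin q) (Fin q) ℝ) (Λ : Set (Fin q)) : Prop :=
  haveI : Fintype ↥Λ := Fintype.ofFinite ↥Λ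
  Matrix.PosDef (Matrix.of fun i j : ↥Λ => K i.1 j.1)

theorem bho_mfcqR
    (s q r : ℕ) (hs : 0 < s) (hq : 0 < q) (hr : 0 < r)
    (A : Matrix (Fin s) (Fin r) ℝ) (B : Matrix (Fin q) (Fin r) ℝ)
    (M : Matrix (Fin s) (Fin q) ℝ) (K : Matrix (Fin q) (Fin q) ℝ)
    (hM : M = A * B.transpose) (hK : K = B * B.transpose)
    (C : ℝ) (ζ z : Fin s → ℝ) (α ξ : Fin q → ℝ)
    -- feasibility of v* = (C, ζ, z, α, ξ)
    (hζ : ∀ i, 0 ≤ ζ i) (hG1 : ∀ i, 0 ≤ M.mulVec α i + z i)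
    (hc1 : ∀ i, ζ i * (M.mulVec α i + z i) = 0)
    (hz : ∀ i, 0 ≤ z i) (hG2 : ∀ i, 0 ≤ 1 - ζ i) (hc2 : ∀ i, z i * (1 - ζ i) = 0)
    (hα : ∀ i, 0 ≤ α i) (hG3 : ∀ i, 0 ≤ K.mulVec α i - 1 + ξ i)
    (hc3 : ∀ i, α i * (K.mulVec α i - 1 + ξ i) = 0)
    (hξ : ∀ i, 0 ≤ ξ i) (hG4 : ∀ i, 0 ≤ C - α i) (hc4 : ∀ i, ξ i * (C - α i) = 0)
    -- standing assumptions
    (hC : 0 < C) (hMα : ∀ i, M.mulVec α i ≠ 0)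
    -- K_(Λ1 ∪ Λ3, Λ1 ∪ Λ3) positive definite
    (hpd : posDefOn K
      ({i : Fin q | α i = 0 ∧ K.mulVec α i - 1 + ξ i = 0 ∧ ξ i = 0} ∪
       {i : Fin q | 0 < α i ∧ α i ≤ C ∧ K.mulVec α i - 1 + ξ i = 0 ∧ ξ i = 0})) :
    -- MPEC-MFCQ-R at v*
    ∀ β γ : BIdx s q → ℝ,
      (∀ idx, bG M K idx (C, ζ, z, α, ξ) ≠ 0 → β idx = 0) →
      (∀ idx, bH idx (C, ζ, z, α, ξ) ≠ 0 → γ idx = 0) →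
      (∀ idx, bG M K idx (C, ζ, z, α, ξ) = 0 → bH idx (C, ζ, z, α, ξ) = 0 →
        0 ≤ β idx ∧ 0 ≤ γ idx) →
      (∑ idx, β idx • bGradG M K idx) + (∑ idx, γ idx • bGradH idx) = 0 →
      β = 0 ∧ γ = 0 := by
  intro β γ hβ hγ hpos heq
  have e2 : ∀ i, -β (Sum.inr (Sum.inl i)) + γ (Sum.inl i) = 0 := by
    intro i
    have h := congrFun (congrArg (fun v : BVec s q => v.2.1) heq) i
    simp [Fintype.sum_sum_type, bGradG, bGradH, Prod.fst_sum, Prod.snd_sum, Finset.sum_apply,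
      Pi.single_apply] at h
    linarith
  have e3 : ∀ i, β (Sum.inl i) + γ (Sum.inr (Sum.inl i)) = 0 := by
    intro i
    have h := congrFun (congrArg (fun v : BVec s q => v.2.2.1) heq) i
    simp [Fintype.sum_sum_type, bGradG, bGradH, Prod.fst_sum, Prod.snd_sum, Finset.sum_apply,
      Pi.single_apply] at h
    linarith
  have e5 : ∀ i, β (Sum.inr (Sum.inr (Sum.inl i))) + γ (Sum.inr (Sum.inr (Sum.inr i))) = 0 := by
    intro i
    have h := congrFun (congrArg (fun v : BVec s q => v.2.2.2.2) heq) i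
    simp [Fintype.sum_sum_type, bGradG, bGradH, Prod.fst_sum, Prod.snd_sum, Finset.sum_apply,
      Pi.single_apply] at h
    linarith
  have e4 : ∀ j, (∑ i, β (Sum.inl i) * M i j)
      + (∑ i, β (Sum.inr (Sum.inr (Sum.inl i))) * K i j)
      - β (Sum.inr (Sum.inr (Sum.inr j))) + γ (Sum.inr (Sum.inr (Sum.inl j))) = 0 := by
    intro i
    have h := congrFun (congrArg (fun v : BVec s q => v.2.2.2.1) heq) i
    simp [Fintype.sum_sum_type, bGradG, bGradH, Prod.fst_sum, Prod.snd_sum, Finset.sum_apply,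
      Pi.single_apply] at h
    linarith
  have b2 : ∀ i, β (Sum.inr (Sum.inl i)) = 0 := by
    intro i
    have h := e2 i
    by_cases h1 : ζ i = 0
    · exact hβ _ (by simp [bG, h1])
    · have := hγ (Sum.inl i) (by simpa [bH] using h1)
      linarith
  have b1 : ∀ i, β (Sum.inl i) = 0 := by
    intro i
    have h := e3 i
    by_cases h1 : z i = 0
    · exact hβ _ (by simpa [bG, h1] using hMα i)
    · have := hγ (Sum.inr (Sum.inl i)) (by simpa [bH] using h1)
      linarith
  have g1 : ∀ i, γ (Sum.inl i) = 0 := fun i => by linarith [e2 i, b2 i]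
  have g2 : ∀ i, γ (Sum.inr (Sum.inl i)) = 0 := fun i => by linarith [e3 i, b1 i]
  simp only [b1, zero_mul, Finset.sum_const_zero, zero_add] at e4
  set b : Fin q → ℝ := fun i => β (Sum.inr (Sum.inr (Sum.inl i))) with hb
  have hsupp : ∀ i, b i ≠ 0 → K.mulVec α i - 1 + ξ i = 0 ∧ ξ i = 0 := by
    intro i hi
    constructor
    · by_contra h
      exact hi (hβ (Sum.inr (Sum.inr (Sum.inl i))) (by simpa [bG] using h))
    · by_contra h
      have := hγ (Sum.inr (Sum.inr (Sum.inr i))) (by simpa [bH] using h)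
      exact hi (by have := e5 i; simp only [hb]; linarith)
  have hterm : ∀ j, b j * (∑ i, b i * K i j) ≤ 0 := by
    intro j
    have h4 := e4 j
    have h5 := e5 j
    have hbj : b j = β (Sum.inr (Sum.inr (Sum.inl j))) := rfl
    by_cases hj : b j = 0
    · simp [hj]
    obtain ⟨hs1, hs2⟩ := hsupp j hj
    have hS : ∑ i, b i * K i j
        = β (Sum.inr (Sum.inr (Sum.inr j))) - γ (Sum.inr (Sum.inr (Sum.inl j))) := by
      simp only [hb]; linarith
    rw [hS]
    by_cases ha : α j = 0
    · have h0 : β (Sum.inr (Sum.inr (Sum.inr j))) = 0 := hβ _ (by simpa [bG, ha] using hC.ne')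
      have hp := hpos (Sum.inr (Sum.inr (Sum.inl j))) (by simpa [bG] using hs1)
        (by simpa [bH] using ha)
      rw [h0, hbj]
      nlinarith [mul_nonneg hp.1 hp.2]
    · have h0 : γ (Sum.inr (Sum.inr (Sum.inl j))) = 0 := hγ _ (by simpa [bH] using ha)
      rw [h0]
      by_cases hc : C - α j = 0
      · have hp := hpos (Sum.inr (Sum.inr (Sum.inr j))) (by simpa [bG] using hc)
          (by simpa [bH] using hs2)
        nlinarith [mul_nonneg hp.1 hp.2]
      · have h1 : β (Sum.inr (Sum.inr (Sum.inr j))) = 0 := hβ _ (by simpa [bG] using hc)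
        simp [h1]
  have hb0 : ∀ i, b i = 0 := by
    set Λ : Set (Fin q) := ({i : Fin q | α i = 0 ∧ K.mulVec α i - 1 + ξ i = 0 ∧ ξ i = 0} ∪
       {i : Fin q | 0 < α i ∧ α i ≤ C ∧ K.mulVec α i - 1 + ξ i = 0 ∧ ξ i = 0}) with hΛ
    have hmem : ∀ i, b i ≠ 0 → i ∈ Λ := by
      intro i hi
      obtain ⟨h1, h2⟩ := hsupp i hi
      rcases (hα i).eq_or_lt with h | h
      · exact Or.inl ⟨h.symm, h1, h2⟩
      · exact Or.inr ⟨h, by linarith [hG4 i], h1, h2⟩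
    unfold posDefOn at hpd
    letI : Fintype ↥Λ := Fintype.ofFinite ↥Λ
    have hsum : ∀ f : Fin q → ℝ, (∀ i, b i = 0 → f i = 0) → ∑ i : Λ, f i.1 = ∑ i, f i := by
      intro f hf
      classical
      rw [← Finset.sum_subtype (Finset.univ.filter (· ∈ Λ)) (by simp) f]
      apply Finset.sum_subset (Finset.subset_univ _)
      intro i _ hi
      apply hf
      by_contra h
      exact hi (by simpa using hmem i h)
    have hle : ∑ j, b j * (∑ i, b i * K i j) ≤ 0 := Finset.sum_nonpos fun j _ => hterm j
    have hz : (fun i : Λ => b i.1) = 0 := by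
      by_contra hne
      have hlt := hpd.dotProduct_mulVec_pos hne
      have hval : star (fun i : Λ => b i.1) ⬝ᵥ
          ((Matrix.of fun i j : ↥Λ => K i.1 j.1).mulVec (fun i : Λ => b i.1))
          = ∑ j, b j * (∑ i, b i * K i j) := by
        have hsym : ∀ i j, K i j = K j i := by
          intro i j
          subst hK
          simp [Matrix.mul_apply, mul_comm]
        rw [← hsum _ (fun i hi => by simp [hi])]
        simp only [dotProduct, Matrix.mulVec, Matrix.of_apply, star_trivial]
        apply Finset.sum_congr rfl
        intro j _
        congr 1
        rw [← hsum (fun i => b i * K i j.1) (fun i hi => by simp [hi])]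
        apply Finset.sum_congr rfl
        intro i _
        rw [hsym, mul_comm]
      exact absurd hle (not_le.mpr (hval ▸ hlt))
    intro i
    by_contra hi
    exact hi (congrFun hz ⟨i, hmem i hi⟩)
  have b3 : ∀ i, β (Sum.inr (Sum.inr (Sum.inl i))) = 0 := hb0
  have g4 : ∀ i, γ (Sum.inr (Sum.inr (Sum.inr i))) = 0 := fun i => by linarith [e5 i, b3 i]
  simp only [b3, zero_mul, Finset.sum_const_zero] at e4
  have b4 : ∀ i, β (Sum.inr (Sum.inr (Sum.inr i))) = 0 := by
    intro i
    have h := e4 i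
    by_cases h1 : α i = 0
    · exact hβ _ (by simpa [bG, h1] using hC.ne')
    · have := hγ (Sum.inr (Sum.inr (Sum.inl i))) (by simpa [bH] using h1)
      linarith
  have g3 : ∀ i, γ (Sum.inr (Sum.inr (Sum.inl i))) = 0 := fun i => by linarith [e4 i, b4 i]
  constructor
  · funext idx
    rcases idx with i | i | i | i
    exacts [b1 i, b2 i, b3 i, b4 i]
  · funext idx
    rcases idx with i | i | i | i
    exacts [g1 i, g2 i, g3 i, g4 i]
end
end

section
/- Let v* = (C, ζ, z, α, ξ) be a feasible point of the BHO-SVM MPEC with C > 0, (Mα)_i ≠ 0 for every i ∈ {1,…,s}, and K_(Λ3⁺, Λ3⁺) positive definite. If |I_GH| = 0 (strict complementarity holds at v*), then MPEC-LICQ holds at v*. -/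
/-!
STATEMENT 13: At a feasible point of the BHO-SVM MPEC with C > 0, (Mα)ᵢ ≠ 0 for all i,
K_(Λ3⁺,Λ3⁺) positive definite and |I_GH| = 0 (strict complementarity), MPEC-LICQ holds.
-/

noncomputable section

theorem aux_li {ι V : Type*} [Fintype ι] [AddCommGroup V] [Module ℝ V] (P Q : ι → Prop)
    (u w : ι → V)
    (h : ∀ a b : ι → ℝ, (∀ i, ¬ P i → a i = 0) → (∀ i, ¬ Q i → b i = 0) →
      ∑ i, a i • u i + ∑ i, b i • w i = 0 → (∀ i, a i = 0) ∧ (∀ i, b i = 0)) :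
    LinearIndependent ℝ (Sum.elim (fun i : {i // P i} => u i.1) (fun i : {i // Q i} => w i.1)) := by
  classical
  rw [Fintype.linearIndependent_iff]
  intro g hg
  have key : ∀ (R : ι → Prop) (f : {i // R i} → ℝ) (y : ι → V),
      ∑ i, (if hi : R i then f ⟨i, hi⟩ else 0) • y i = ∑ i : {i // R i}, f i • y i.1 := by
    intro R f y
    have h1 : ∑ i ∈ Finset.univ.filter R, (if hi : R i then f ⟨i, hi⟩ else 0) • y i
        = ∑ i, (if hi : R i then f ⟨i, hi⟩ else 0) • y i := by
      apply Finset.sum_subset (Finset.subset_univ _)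
      intro i _ hi
      have : ¬ R i := by simpa using hi
      simp [this]
    rw [← h1, Finset.sum_subtype (p := R) _ (by simp)]
    apply Finset.sum_congr rfl
    intro i _
    simp [i.2]
  have := h (fun i => if hi : P i then g (Sum.inl ⟨i, hi⟩) else 0)
    (fun i => if hi : Q i then g (Sum.inr ⟨i, hi⟩) else 0)
    (fun i hi => by simp [hi]) (fun i hi => by simp [hi])
    (by
      rw [key P (fun i => g (Sum.inl i)), key Q (fun i => g (Sum.inr i))]
      simpa [Fintype.sum_sum_type] using hg)
  rintro (⟨i, hi⟩ | ⟨i, hi⟩)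
  · simpa [hi] using this.1 i
  · simpa [hi] using this.2 i

theorem aux_pd {q : ℕ} (K : Matrix (Fin q) (Fin q) ℝ) (L : Set (Fin q)) (h : posDefOn K L)
    (c : Fin q → ℝ) (hc : ∀ i, i ∉ L → c i = 0) (h0 : ∀ j ∈ L, ∑ i, c i * K i j = 0) :
    ∀ i, c i = 0 := by
  classical
  unfold posDefOn at h
  letI : Fintype ↥L := Fintype.ofFinite ↥L
  by_contra hne
  push Not at hne
  obtain ⟨k, hk⟩ := hne
  have hkL : k ∈ L := by
    by_contra hh
    exact hk (hc k hh)
  have hx : (fun i : L => c i.1) ≠ 0 := fun hh => hk (congrFun hh ⟨k, hkL⟩)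
  have hp := h.dotProduct_mulVec_pos hx
  rw [Matrix.dotProduct_mulVec] at hp
  have hz : Matrix.vecMul (star (fun i : L => c i.1)) (Matrix.of fun i j : ↥L => K i.1 j.1) = 0 := by
    funext j
    have e := h0 j.1 j.2
    rw [← Finset.sum_subset (Finset.subset_univ (Finset.univ.filter (· ∈ L)))
      (by intro i _ hi; rw [hc i (by simpa using hi)]; simp),
      Finset.sum_subtype (p := (· ∈ L)) _ (by simp)] at e
    simpa [Matrix.vecMul, dotProduct] using e
  rw [hz] at hp
  simp at hp

theorem bho_licq_of_strict_complementarity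
    (s q r : ℕ) (hs : 0 < s) (hq : 0 < q) (hr : 0 < r)
    (A : Matrix (Fin s) (Fin r) ℝ) (B : Matrix (Fin q) (Fin r) ℝ)
    (M : Matrix (Fin s) (Fin q) ℝ) (K : Matrix (Fin q) (Fin q) ℝ)
    (hM : M = A * B.transpose) (hK : K = B * B.transpose)
    (C : ℝ) (ζ z : Fin s → ℝ) (α ξ : Fin q → ℝ)
    -- feasibility of v* = (C, ζ, z, α, ξ)
    (hζ : ∀ i, 0 ≤ ζ i) (hG1 : ∀ i, 0 ≤ M.mulVec α i + z i)
    (hc1 : ∀ i, ζ i * (M.mulVec α i + z i) = 0)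
    (hz : ∀ i, 0 ≤ z i) (hG2 : ∀ i, 0 ≤ 1 - ζ i) (hc2 : ∀ i, z i * (1 - ζ i) = 0)
    (hα : ∀ i, 0 ≤ α i) (hG3 : ∀ i, 0 ≤ K.mulVec α i - 1 + ξ i)
    (hc3 : ∀ i, α i * (K.mulVec α i - 1 + ξ i) = 0)
    (hξ : ∀ i, 0 ≤ ξ i) (hG4 : ∀ i, 0 ≤ C - α i) (hc4 : ∀ i, ξ i * (C - α i) = 0)
    -- standing assumptions
    (hC : 0 < C) (hMα : ∀ i, M.mulVec α i ≠ 0)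
    -- K_(Λ3⁺, Λ3⁺) positive definite
    (hpd : posDefOn K
      {i : Fin q | 0 < α i ∧ α i < C ∧ K.mulVec α i - 1 + ξ i = 0 ∧ ξ i = 0})
    -- |I_GH| = 0
    (hGH : {idx : BIdx s q |
        bG M K idx (C, ζ, z, α, ξ) = 0 ∧ bH idx (C, ζ, z, α, ξ) = 0} = ∅) :
    -- MPEC-LICQ holds at v*
    LinearIndependent ℝ
      (Sum.elim
        (fun i : {idx : BIdx s q // bG M K idx (C, ζ, z, α, ξ) = 0} => bGradG M K i.1)
        (fun i : {idx : BIdx s q // bH idx (C, ζ, z, α, ξ) = 0} => bGradH i.1)) := by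
  apply aux_li (fun idx => bG M K idx (C, ζ, z, α, ξ) = 0) (fun idx => bH idx (C, ζ, z, α, ξ) = 0)
    (bGradG M K) bGradH
  intro a b ha hb hsum
  have hsc : ∀ idx, bG M K idx (C, ζ, z, α, ξ) = 0 → bH idx (C, ζ, z, α, ξ) = 0 → False := by
    intro idx h1 h2
    have : idx ∈ ({} : Set (BIdx s q)) := by rw [← hGH]; exact ⟨h1, h2⟩
    exact this
  -- coordinates
  simp only [Fintype.sum_sum_type, bGradG, bGradH] at hsum
  have e2 := fun i => congrFun (congrArg (fun v : BVec s q => v.2.1) hsum) i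
  have e3 := fun i => congrFun (congrArg (fun v : BVec s q => v.2.2.1) hsum) i
  have e4 := fun i => congrFun (congrArg (fun v : BVec s q => v.2.2.2.1) hsum) i
  have e5 := fun i => congrFun (congrArg (fun v : BVec s q => v.2.2.2.2) hsum) i
  clear hsum
  simp [Prod.fst_sum, Prod.snd_sum, Finset.sum_apply, Pi.single_apply] at e2 e3 e4 e5
  have s1 := fun i => hsc (Sum.inl i)
  have s2 := fun i => hsc (Sum.inr (Sum.inl i))
  have s3 := fun i => hsc (Sum.inr (Sum.inr (Sum.inl i)))
  have s4 := fun i => hsc (Sum.inr (Sum.inr (Sum.inr i)))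
  have a1 := fun i => ha (Sum.inl i)
  have a2 := fun i => ha (Sum.inr (Sum.inl i))
  have a3 := fun i => ha (Sum.inr (Sum.inr (Sum.inl i)))
  have a4 := fun i => ha (Sum.inr (Sum.inr (Sum.inr i)))
  have b1 := fun i => hb (Sum.inl i)
  have b2 := fun i => hb (Sum.inr (Sum.inl i))
  have b3 := fun i => hb (Sum.inr (Sum.inr (Sum.inl i)))
  have b4 := fun i => hb (Sum.inr (Sum.inr (Sum.inr i)))
  simp only [bG, bH] at s1 s2 s3 s4 a1 a2 a3 a4 b1 b2 b3 b4
  have fa2 : ∀ i, a (Sum.inr (Sum.inl i)) = 0 := by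
    intro i
    by_cases h : 1 - ζ i = 0
    · have := b1 i (by intro h'; rw [h'] at h; norm_num at h)
      linarith [e2 i]
    · exact a2 i h
  have fb1 : ∀ i, b (Sum.inl i) = 0 := fun i => by linarith [e2 i, fa2 i]
  have fa1 : ∀ i, a (Sum.inl i) = 0 := by
    intro i
    by_cases h : M.mulVec α i + z i = 0
    · have := b2 i (by intro h'; rw [h', add_zero] at h; exact hMα i h)
      linarith [e3 i]
    · exact a1 i h
  have fb2 : ∀ i, b (Sum.inr (Sum.inl i)) = 0 := fun i => by linarith [e3 i, fa1 i]
  have fa3 : ∀ i, a (Sum.inr (Sum.inr (Sum.inl i))) = 0 := by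
    apply aux_pd K _ hpd (fun i => a (Sum.inr (Sum.inr (Sum.inl i))))
    · intro i hi
      by_contra hne
      have h3 : K.mulVec α i - 1 + ξ i = 0 := by
        by_contra h
        exact hne (a3 i h)
      have hx : ξ i = 0 := by
        by_contra h
        exact hne (by linarith [e5 i, b4 i h])
      refine hi ⟨lt_of_le_of_ne (hα i) (fun h => s3 i h3 h.symm), ?_, h3, hx⟩
      exact lt_of_le_of_ne (by linarith [hG4 i]) (fun h => s4 i (by linarith) hx)
    · rintro j ⟨h1, h2, -, -⟩
      have := e4 j
      rw [a4 j (sub_pos.mpr h2).ne', b3 j h1.ne'] at this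
      simpa [fa1] using this
  have fb4 : ∀ i, b (Sum.inr (Sum.inr (Sum.inr i))) = 0 := fun i => by linarith [e5 i, fa3 i]
  have e4' : ∀ i, a (Sum.inr (Sum.inr (Sum.inr i))) = b (Sum.inr (Sum.inr (Sum.inl i))) := by
    intro i
    have := e4 i
    simp only [fa1, fa3, zero_mul, Finset.sum_const_zero] at this
    linarith
  have fa4 : ∀ i, a (Sum.inr (Sum.inr (Sum.inr i))) = 0 := by
    intro i
    by_cases h : C - α i = 0
    · rw [e4' i]
      exact b3 i (by intro h'; rw [h'] at h; linarith)
    · exact a4 i h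
  have fb3 : ∀ i, b (Sum.inr (Sum.inr (Sum.inl i))) = 0 := fun i => by rw [← e4' i, fa4 i]
  constructor
  · rintro (i | i | i | i)
    exacts [fa1 i, fa2 i, fa3 i, fa4 i]
  · rintro (i | i | i | i)
    exacts [fb1 i, fb2 i, fb3 i, fb4 i]
end
end

section
/- Let q, r be positive integers, B ∈ ℝ^{q×r}, K = B·Bᵀ, and let Λ2, Λ3⁺, Λu be pairwise disjoint subsets of {1,…,q} such that K_(Λ3⁺, Λ3⁺) is positive definite (or Λ3⁺ = ∅). Then the following vectors in ℝ × ℝ^q × ℝ^q are linearly independent: (0, K_{i,·}, e_i) for i ∈ Λ3⁺; (0, e_i, 0) for i ∈ Λ2; (1, −e_i, 0) for i ∈ Λu; and (0, 0, e_i) for i ∈ Λ3⁺, where K_{i,·} is the i-th row of K and e_i is the i-th standard basis vector of ℝ^q. -/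
/-!
STATEMENT 16 (Lemma on Γ_sub1): given pairwise disjoint Λ2, Λ3⁺, Λu ⊆ {1,…,q} with
K_(Λ3⁺,Λ3⁺) positive definite (or Λ3⁺ = ∅), the listed vectors in ℝ × ℝ^q × ℝ^q are
linearly independent.
-/

noncomputable section

theorem gammaSub1_linearIndependent
    (q r : ℕ) (hq : 0 < q) (hr : 0 < r)
    (B : Matrix (Fin q) (Fin r) ℝ) (K : Matrix (Fin q) (Fin q) ℝ)
    (hK : K = B * B.transpose)
    (Λ2 Λ3p Λu : Set (Fin q))
    (h23 : Disjoint Λ2 Λ3p) (h2u : Disjoint Λ2 Λu) (h3u : Disjoint Λ3p Λu)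
    (hpd : Λ3p = ∅ ∨ posDefOn K Λ3p) :
    LinearIndependent ℝ
      (Sum.elim
        (fun i : ↥Λ3p =>
          (((0 : ℝ), fun j => K i.1 j, Pi.single i.1 1) : ℝ × (Fin q → ℝ) × (Fin q → ℝ)))
        (Sum.elim
          (fun i : ↥Λ2 =>
            (((0 : ℝ), Pi.single i.1 1, 0) : ℝ × (Fin q → ℝ) × (Fin q → ℝ)))
          (Sum.elim
            (fun i : ↥Λu =>
              (((1 : ℝ), -Pi.single i.1 1, 0) : ℝ × (Fin q → ℝ) × (Fin q → ℝ)))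
            (fun i : ↥Λ3p =>
              (((0 : ℝ), 0, Pi.single i.1 1) : ℝ × (Fin q → ℝ) × (Fin q → ℝ)))))) := by
  classical
  letI i3 : Fintype ↥Λ3p := Fintype.ofFinite ↥Λ3p
  letI i2 : Fintype ↥Λ2 := Fintype.ofFinite ↥Λ2
  letI iu : Fintype ↥Λu := Fintype.ofFinite ↥Λu
  rw [Fintype.linearIndependent_iff]
  intro g hg
  simp only [Fintype.sum_sum_type, Sum.elim_inl, Sum.elim_inr] at hg
  have e2 : ∀ j : Fin q, (∑ i : ↥Λ3p, g (Sum.inl i) * K i.1 j)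
      + ((∑ i : ↥Λ2, g (Sum.inr (Sum.inl i)) * (Pi.single i.1 1 : Fin q → ℝ) j)
      + (∑ i : ↥Λu, g (Sum.inr (Sum.inr (Sum.inl i))) * -(Pi.single i.1 1 : Fin q → ℝ) j)) = 0 := by
    intro j
    have h := congrFun (congrArg (fun p => p.2.1) hg) j
    simpa [Prod.snd_sum, Prod.fst_sum, Finset.sum_apply] using h
  have e3 : ∀ j : Fin q, (∑ i : ↥Λ3p, g (Sum.inl i) * (Pi.single i.1 1 : Fin q → ℝ) j)
      + (∑ i : ↥Λ3p, g (Sum.inr (Sum.inr (Sum.inr i))) * (Pi.single i.1 1 : Fin q → ℝ) j) = 0 := by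
    intro j
    have h := congrFun (congrArg (fun p => p.2.2) hg) j
    simpa [Prod.snd_sum, Prod.fst_sum, Finset.sum_apply] using h
  have key : ∀ (S : Set (Fin q)) (_ : Fintype ↥S) (f : ↥S → ℝ) (j : ↥S),
      ∑ i : ↥S, f i * (Pi.single i.1 1 : Fin q → ℝ) j.1 = f j := by
    intro S _ f j
    rw [Finset.sum_eq_single j]
    · simp
    · intro b _ hb
      have : j.1 ≠ b.1 := fun h => hb (Subtype.ext h.symm)
      simp [Pi.single_apply, this]
    · simp
  have key0 : ∀ (S : Set (Fin q)) (_ : Fintype ↥S) (f : ↥S → ℝ) (j : Fin q), j ∉ S →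
      ∑ i : ↥S, f i * (Pi.single i.1 1 : Fin q → ℝ) j = 0 := by
    intro S _ f j hj
    apply Finset.sum_eq_zero
    intro b _
    have : j ≠ b.1 := fun h => hj (h ▸ b.2)
    simp [Pi.single_apply, this]
  simp only [mul_neg, Finset.sum_neg_distrib] at e2
  have a0 : ∀ i : ↥Λ3p, g (Sum.inl i) = 0 := by
    rcases hpd with h | h
    · subst h
      intro i
      exact i.2.elim
    · have hu : IsUnit (Matrix.of fun i j : ↥Λ3p => K i.1 j.1) := Matrix.PosDef.isUnit h
      have hinj := Matrix.vecMul_injective_iff_isUnit.mpr hu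
      have hz : (fun i : ↥Λ3p => g (Sum.inl i)) = 0 := by
        apply hinj
        funext j
        have h := e2 j.1
        rw [key0 Λ2 i2 _ j.1 (Set.disjoint_right.mp h23 j.2),
          key0 Λu iu _ j.1 (Set.disjoint_left.mp h3u j.2)] at h
        simpa [Matrix.vecMul, dotProduct] using h
      exact fun i => congrFun hz i
  simp only [a0, zero_mul, Finset.sum_const_zero, zero_add] at e2 e3
  rintro (i | i | i | i)
  · exact a0 i
  · have h := e2 i.1
    rw [key Λ2 i2 (fun i => g (Sum.inr (Sum.inl i))) i,
      key0 Λu iu _ i.1 (Set.disjoint_left.mp h2u i.2)] at h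
    simpa using h
  · have h := e2 i.1
    rw [key0 Λ2 i2 _ i.1 (Set.disjoint_right.mp h2u i.2),
      key Λu iu (fun i => g (Sum.inr (Sum.inr (Sum.inl i)))) i] at h
    simpa using h
  · have h := e3 i.1
    rwa [key Λ3p i3 (fun i => g (Sum.inr (Sum.inr (Sum.inr i)))) i] at h
end
end

section
/- Let q, r be positive integers, B ∈ ℝ^{q×r}, K = B·Bᵀ, and let Λ1, Λ2, Λ3⁺, Λu be pairwise disjoint subsets whose union is {1,…,q}, with |Λ1| = 1 and K_(Λ3⁺, Λ3⁺) positive definite (or Λ3⁺ = ∅). Set A₃ = K_(Λ1, Λ3⁺)·(K_(Λ3⁺, Λ3⁺))⁻¹ (A₃ = 0 if Λ3⁺ = ∅) and â₃ = K_(Λ1, Λu)·1 − A₃·K_(Λ3⁺, Λu)·1 ∈ ℝ. Then the following vectors in ℝ × ℝ^q × ℝ^q are linearly independent if and only if â₃ ≠ 0: (0, K_{i,·}, e_i) for i ∈ Λ3⁺; (0, K_{i,·}, e_i) for i ∈ Λ1; (0, e_i, 0) for i ∈ Λ1; (0, e_i, 0) for i ∈ Λ2; (1, −e_i, 0) for i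 ∈ Λu; (0, 0, e_i) for i ∈ Λ1; and (0, 0, e_i) for i ∈ Λ3⁺, where K_{i,·} is the i-th row of K and e_i is the i-th standard basis vector of ℝ^q. -/
/-!
STATEMENT 17 (Lemma on Γ_sub2): given pairwise disjoint Λ1, Λ2, Λ3⁺, Λu covering
{1,…,q}, with Λ1 = {i0} and K_(Λ3⁺,Λ3⁺) positive definite (or Λ3⁺ = ∅), the listed
vectors in ℝ × ℝ^q × ℝ^q are linearly independent iff â₃ ≠ 0, where
â₃ = K_(Λ1,Λu)·1 − K_(Λ1,Λ3⁺)·(K_(Λ3⁺,Λ3⁺))⁻¹·K_(Λ3⁺,Λu)·1.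
-/

noncomputable section

/-- `âhat K i0 Λp Λcol = K_({i0}, Λcol)·1 − (K_({i0}, Λp)·(K_(Λp,Λp))⁻¹)·K_(Λp, Λcol)·1`.
If `Λp = ∅` the second term vanishes (the convention `A = 0`). -/
def ahat {q : ℕ} (K : Matrix (Fin q) (Fin q) ℝ) (i0 : Fin q)
    (Λp Λcol : Set (Fin q)) : ℝ :=
  haveI : Fintype ↥Λp := Fintype.ofFinite ↥Λp
  haveI : Fintype ↥Λcol := Fintype.ofFinite ↥Λcol
  haveI : DecidableEq ↥Λp := Classical.decEq _
  (∑ j : ↥Λcol, K i0 j.1) -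
    ∑ j : ↥Λcol, ∑ k : ↥Λp,
      Matrix.vecMul (fun t : ↥Λp => K i0 t.1)
        (Matrix.of fun a b : ↥Λp => K a.1 b.1)⁻¹ k * K k.1 j.1

theorem aux_sum_single {q : ℕ} (S : Set (Fin q)) [Fintype S] (f : S → ℝ) (j : Fin q) (hj : j ∈ S) :
    ∑ i : S, f i * (Pi.single (M := fun _ => ℝ) i.1 1 : Fin q → ℝ) j = f ⟨j, hj⟩ := by
  rw [Finset.sum_eq_single ⟨j, hj⟩]
  · simp
  · intro b _ hb
    rw [Pi.single_eq_of_ne, mul_zero]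
    intro h
    exact hb (Subtype.ext h.symm)
  · simp

theorem aux_sum_single_not {q : ℕ} (S : Set (Fin q)) [Fintype S] (f : S → ℝ) (j : Fin q)
    (hj : j ∉ S) :
    ∑ i : S, f i * (Pi.single (M := fun _ => ℝ) i.1 1 : Fin q → ℝ) j = 0 := by
  apply Finset.sum_eq_zero
  intro b _
  rw [Pi.single_eq_of_ne, mul_zero]
  intro h
  exact hj (h ▸ b.2)

theorem gammaSub2_linearIndependent_iff
    (q r : ℕ) (hq : 0 < q) (hr : 0 < r)
    (B : Matrix (Fin q) (Fin r) ℝ) (K : Matrix (Fin q) (Fin q) ℝ)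
    (hK : K = B * B.transpose)
    (Λ1 Λ2 Λ3p Λu : Set (Fin q))
    (h12 : Disjoint Λ1 Λ2) (h13 : Disjoint Λ1 Λ3p) (h1u : Disjoint Λ1 Λu)
    (h23 : Disjoint Λ2 Λ3p) (h2u : Disjoint Λ2 Λu) (h3u : Disjoint Λ3p Λu)
    (hcover : Λ1 ∪ Λ2 ∪ Λ3p ∪ Λu = Set.univ)
    (i0 : Fin q) (hΛ1 : Λ1 = {i0})
    (hpd : Λ3p = ∅ ∨ posDefOn K Λ3p) :
    LinearIndependent ℝ
      (Sum.elim
        (fun i : ↥Λ3p =>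
          (((0 : ℝ), fun j => K i.1 j, Pi.single i.1 1) : ℝ × (Fin q → ℝ) × (Fin q → ℝ)))
        (Sum.elim
          (fun i : ↥Λ1 =>
            (((0 : ℝ), fun j => K i.1 j, Pi.single i.1 1) : ℝ × (Fin q → ℝ) × (Fin q → ℝ)))
          (Sum.elim
            (fun i : ↥Λ1 =>
              (((0 : ℝ), Pi.single i.1 1, 0) : ℝ × (Fin q → ℝ) × (Fin q → ℝ)))
            (Sum.elim
              (fun i : ↥Λ2 =>
                (((0 : ℝ), Pi.single i.1 1, 0) : ℝ × (Fin q → ℝ) × (Fin q → ℝ)))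
              (Sum.elim
                (fun i : ↥Λu =>
                  (((1 : ℝ), -Pi.single i.1 1, 0) : ℝ × (Fin q → ℝ) × (Fin q → ℝ)))
                (Sum.elim
                  (fun i : ↥Λ1 =>
                    (((0 : ℝ), 0, Pi.single i.1 1) : ℝ × (Fin q → ℝ) × (Fin q → ℝ)))
                  (fun i : ↥Λ3p =>
                    (((0 : ℝ), 0, Pi.single i.1 1) : ℝ × (Fin q → ℝ) × (Fin q → ℝ)))))))))
    ↔ ahat K i0 Λ3p Λu ≠ 0 := by
  subst hΛ1
  let i3 : Fintype ↥Λ3p := Fintype.ofFinite ↥Λ3p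
  let iu : Fintype ↥Λu := Fintype.ofFinite ↥Λu
  let i2 : Fintype ↥Λ2 := Fintype.ofFinite ↥Λ2
  let d3 : DecidableEq ↥Λ3p := Classical.decEq _
  have hn2 : i0 ∉ Λ2 := by simpa using h12
  have hn3 : i0 ∉ Λ3p := by simpa using h13
  have hnu : i0 ∉ Λu := by simpa using h1u
  have hdet : IsUnit (Matrix.of fun a b : ↥Λ3p => K a.1 b.1).det := by
    rcases hpd with h | h
    · have : IsEmpty ↥Λ3p := by rw [h]; infer_instance
      rw [Matrix.det_isEmpty]; exact isUnit_one
    · have h' : Matrix.PosDef (Matrix.of fun a b : ↥Λ3p => K a.1 b.1) := h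
      exact isUnit_iff_ne_zero.mpr h'.det_pos.ne'
  obtain ⟨M, hM⟩ : ∃ M, M = (Matrix.of fun a b : ↥Λ3p => K a.1 b.1) := ⟨_, rfl⟩
  obtain ⟨v, hv⟩ : ∃ v, v = Matrix.vecMul (fun t : ↥Λ3p => K i0 t.1) M⁻¹ := ⟨_, rfl⟩
  have hah : ahat K i0 Λ3p Λu = ∑ j : ↥Λu, (K i0 j.1 - ∑ k : ↥Λ3p, v k * K k.1 j.1) := by
    rw [hv, hM, Finset.sum_sub_distrib]; rfl
  rw [← hM] at hdet
  have hvM : ∀ j : ↥Λ3p, ∑ k : ↥Λ3p, v k * K k.1 j.1 = K i0 j.1 := by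
    intro j
    have : Matrix.vecMul v M = fun t : ↥Λ3p => K i0 t.1 := by
      rw [hv, Matrix.vecMul_vecMul, Matrix.nonsing_inv_mul _ hdet, Matrix.vecMul_one]
    have h2 := congrFun this j
    rw [← h2, hM]; rfl
  have huniq : ∀ w : ↥Λ3p → ℝ, ∀ b : ℝ,
      (∀ j : ↥Λ3p, ∑ k : ↥Λ3p, w k * K k.1 j.1 = b * K i0 j.1) → w = b • v := by
    intro w b hw
    have h1 : Matrix.vecMul w M = b • fun t : ↥Λ3p => K i0 t.1 := by
      funext j
      rw [hM]; exact hw j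
    have h2 := congrArg (fun x => Matrix.vecMul x M⁻¹) h1
    simp only [Matrix.vecMul_vecMul, Matrix.mul_nonsing_inv _ hdet, Matrix.vecMul_one,
      Matrix.smul_vecMul, ← hv] at h2
    exact h2
  rw [Fintype.linearIndependent_iff, hah]
  simp only [Fintype.sum_sum_type, Sum.elim_inl, Sum.elim_inr, Prod.ext_iff, funext_iff,
    Prod.fst_add, Prod.snd_add, Prod.fst_sum, Prod.snd_sum, Prod.smul_fst, Prod.smul_snd,
    Pi.add_apply, Finset.sum_apply, Pi.smul_apply, smul_eq_mul, Pi.neg_apply, Prod.fst_zero,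
    Prod.snd_zero, Pi.zero_apply, mul_zero, mul_one, Finset.sum_const_zero, zero_add, add_zero,
    Sum.forall, mul_neg, Finset.sum_neg_distrib]
  constructor
  · intro H h0
    have := (H (Sum.elim (fun i => - v i) (Sum.elim (fun _ => 1)
      (Sum.elim (fun _ => - (K i0 i0 - ∑ k : ↥Λ3p, v k * K k.1 i0))
      (Sum.elim (fun j => - (K i0 j.1 - ∑ k : ↥Λ3p, v k * K k.1 j.1))
      (Sum.elim (fun j => (K i0 j.1 - ∑ k : ↥Λ3p, v k * K k.1 j.1))
      (Sum.elim (fun _ => -1) (fun i => v i))))))) ?_).2.1 ⟨i0, rfl⟩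
    · simp at this
    · simp only [Sum.elim_inl, Sum.elim_inr]
      refine ⟨h0, ?_, ?_⟩
      · intro j
        simp only [Fintype.sum_unique, Set.default_coe_singleton, neg_mul, one_mul, Finset.sum_neg_distrib]
        have hj : j ∈ {i0} ∪ Λ2 ∪ Λ3p ∪ Λu := by rw [hcover]; trivial
        rcases hj with ((hj | hj) | hj) | hj
        · have hj' : j = i0 := hj
          subst hj'
          rw [aux_sum_single_not Λ2 _ j hn2, aux_sum_single_not Λu _ j hnu]
          simp
        · have e1 : j ≠ i0 := fun h => hn2 (h ▸ hj)
          have e2 : j ∉ Λu := fun h => Set.disjoint_left.mp h2u hj h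
          rw [aux_sum_single Λ2 _ j hj, aux_sum_single_not Λu _ j e2, Pi.single_eq_of_ne e1]
          ring
        · have e1 : j ≠ i0 := fun h => hn3 (h ▸ hj)
          have e2 : j ∉ Λu := fun h => Set.disjoint_left.mp h3u hj h
          have e3 : j ∉ Λ2 := fun h => Set.disjoint_left.mp h23 h hj
          rw [aux_sum_single_not Λ2 _ j e3, aux_sum_single_not Λu _ j e2, Pi.single_eq_of_ne e1]
          have := hvM ⟨j, hj⟩
          simp only at this
          rw [this]
          ring
        · have e1 : j ≠ i0 := fun h => hnu (h ▸ hj)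
          have e2 : j ∉ Λ2 := fun h => Set.disjoint_left.mp h2u h hj
          rw [aux_sum_single_not Λ2 _ j e2, aux_sum_single Λu _ j hj, Pi.single_eq_of_ne e1]
          ring
      · intro j
        simp
  · intro h0 g hg
    obtain ⟨hC, hA, hX⟩ := hg
    simp only [Fintype.sum_unique, Set.default_coe_singleton] at hA hX
    set b := g (Sum.inr (Sum.inl ⟨i0, rfl⟩)) with hb
    have ha : (fun k : ↥Λ3p => g (Sum.inl k)) = (-b) • v := by
      apply huniq
      rintro ⟨j, hj⟩
      have h := hA j
      have e1 : j ≠ i0 := fun h => hn3 (h ▸ hj)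
      have e2 : j ∉ Λu := fun h => Set.disjoint_left.mp h3u hj h
      have e3 : j ∉ Λ2 := fun h => Set.disjoint_left.mp h23 h hj
      rw [aux_sum_single_not Λ2 _ j e3, aux_sum_single_not Λu _ j e2, Pi.single_eq_of_ne e1] at h
      simp only
      linarith
    have ha' : ∀ k : ↥Λ3p, g (Sum.inl k) = -b * v k := fun k => congrFun ha k
    simp only [ha', mul_assoc, ← Finset.mul_sum] at hA
    have hu : ∀ j : ↥Λu, g (Sum.inr (Sum.inr (Sum.inr (Sum.inr (Sum.inl j))))) =
        b * (K i0 j.1 - ∑ k : ↥Λ3p, v k * K k.1 j.1) := by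
      rintro ⟨j, hj⟩
      have h := hA j
      have e1 : j ≠ i0 := fun h => hnu (h ▸ hj)
      have e2 : j ∉ Λ2 := fun h => Set.disjoint_left.mp h2u h hj
      rw [aux_sum_single_not Λ2 _ j e2, aux_sum_single Λu _ j hj, Pi.single_eq_of_ne e1] at h
      simp only
      linarith
    have hb0 : b = 0 := by
      simp only [hu, ← Finset.mul_sum] at hC
      exact (mul_eq_zero.mp hC).resolve_right h0
    have ha0 : ∀ k : ↥Λ3p, g (Sum.inl k) = 0 := fun k => by rw [ha', hb0]; ring
    have hu0 : ∀ j : ↥Λu, g (Sum.inr (Sum.inr (Sum.inr (Sum.inr (Sum.inl j))))) = 0 :=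
      fun j => by rw [hu, hb0]; ring
    simp only [hb0, hu0, neg_zero, zero_mul, zero_add, Finset.sum_const_zero, add_zero] at hA
    simp only [hb0, ha0, zero_mul, zero_add, Finset.sum_const_zero] at hX
    refine ⟨ha0, ?_, ?_, ?_, hu0, ?_, ?_⟩
    · rintro ⟨j, rfl⟩; exact hb0
    · rintro ⟨j, rfl⟩
      have h := hA j
      rw [aux_sum_single_not Λ2 _ j hn2] at h
      simpa using h
    · rintro ⟨j, hj⟩
      have h := hA j
      have e1 : j ≠ i0 := fun h => hn2 (h ▸ hj)
      rw [aux_sum_single Λ2 _ j hj, Pi.single_eq_of_ne e1] at h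
      simpa using h
    · rintro ⟨j, rfl⟩
      have h := hX j
      rw [aux_sum_single_not Λ3p _ j hn3] at h
      simpa using h
    · rintro ⟨j, hj⟩
      have h := hX j
      have e1 : j ≠ i0 := fun h => hn3 (h ▸ hj)
      rw [aux_sum_single Λ3p _ j hj, Pi.single_eq_of_ne e1] at h
      simpa using h
end
end
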